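/- Let (J,a) be a partial m×n matrix over a field 𝔽, let b ≥ 1, and let A be a completion of (J,a)⊗I_b such that for every pair (i,j) ∈ {1,…,m}×{1,…,n} the b×b block A^{(i,j)} = (A_{(i,p),(j,q)})_{1 ≤ p,q ≤ b} is upper triangular. Then rank(A) ≥ b · mr(J,a). -/

import Mathlib

open Matrix

variable {F : Type*} [Field F] {m n : Type*} [Fintype m] [Fintype n]

/-- `B` is a completion of the partial matrix `(J, a)`: it agrees with the
prescribed entries on the pattern `J`. -/
def Completes (J : Set (m × n)) (a : m → n → F) (B : Matrix m n F) : Prop :=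
  ∀ p ∈ J, B p.1 p.2 = a p.1 p.2

/-- Minimal rank of the partial matrix `(J, a)`: the minimum of the ranks of
all completions. -/
noncomputable def pmr (J : Set (m × n)) (a : m → n → F) : ℕ :=
  sInf {r : ℕ | ∃ B : Matrix m n F, Completes J a B ∧ B.rank = r}

/-- A pattern `T` is triangular if whenever `(i,j) ∈ T` and `(k,l) ∈ T`,
then `(i,l) ∈ T` or `(k,j) ∈ T`. -/
def Triangular (T : Set (m × n)) : Prop :=
  ∀ p ∈ T, ∀ q ∈ T, (p.1, q.2) ∈ T ∨ (q.1, p.2) ∈ T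

/-- Triangular minimal rank: the maximum of `pmr` over triangular
subpatterns of `J`. -/
noncomputable def ptmr (J : Set (m × n)) (a : m → n → F) : ℕ :=
  sSup {r : ℕ | ∃ T ⊆ J, Triangular T ∧ pmr T a = r}

/-- Pattern of the tensor `(J,a) ⊗ I_b`. -/
def TensorJ (J : Set (m × n)) (b : ℕ) : Set ((m × Fin b) × (n × Fin b)) :=
  {p | (p.1.1, p.2.1) ∈ J}

/-- Entries of the tensor `(J,a) ⊗ I_b`: `a i j` on the diagonal of each
`b × b` block, `0` off the diagonal. -/
def TensorA (a : m → n → F) (b : ℕ) : m × Fin b → n × Fin b → F :=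
  fun ip jq => if ip.2 = jq.2 then a ip.1 jq.1 else 0

/-- `b`-fold minimal rank `mr_b(J,a) = mr((J,a) ⊗ I_b)`. -/
noncomputable def pmrb (J : Set (m × n)) (a : m → n → F) (b : ℕ) : ℕ :=
  pmr (TensorJ J b) (TensorA a b)

/-- Fractional minimal rank: `inf_{b ≥ 1} mr_b(J,a) / b`. -/
noncomputable def pfmr (J : Set (m × n)) (a : m → n → F) : ℝ :=
  ⨅ b : ℕ+, (pmrb J a b : ℝ) / (b : ℝ)

omit [Fintype m] in
theorem pmr_le_rank {J : Set (m × n)} {a : m → n → F} {B : Matrix m n F}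
    (hB : Completes J a B) : pmr J a ≤ B.rank :=
  Nat.sInf_le ⟨B, hB, rfl⟩

theorem Matrix.exists_linearIndependent_cols (B : Matrix m n F) {r : ℕ} (hr : r ≤ B.rank) :
    ∃ g : Fin r → n, LinearIndependent F fun k => B.col (g k) := by
  rw [Matrix.rank_eq_finrank_span_cols] at hr
  obtain ⟨f, hf, -, hli⟩ := Submodule.exists_fun_fin_finrank_span_eq F (Set.range B.col)
  choose g hg using hf
  refine ⟨fun k => g (Fin.castLE hr k), ?_⟩
  simp only [hg]
  exact hli.comp _ (Fin.castLE_injective hr)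

/-- A block upper triangular matrix whose `b` diagonal blocks have rank at least `r` has rank
at least `b * r`. -/
theorem Matrix.mul_le_rank_of_blockUpperTriangular {b r : ℕ}
    (A : Matrix (m × Fin b) (n × Fin b) F)
    (htri : ∀ (i : m) (j : n) (p q : Fin b), q < p → A (i, p) (j, q) = 0)
    (hr : ∀ p, r ≤ (A.submatrix (fun i => (i, p)) (fun j => (j, p))).rank) :
    b * r ≤ A.rank := by
  choose g hg using fun p => Matrix.exists_linearIndependent_cols _ (hr p)
  have hli : LinearIndependent F fun x : Fin b × Fin r => A.col (g x.1 x.2, x.1) := by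
    rw [Fintype.linearIndependent_iff]
    intro c hc
    suffices h : ∀ p k, c (p, k) = 0 from fun x => h x.1 x.2
    intro p
    induction p using WellFoundedGT.induction with
    | ind p ih =>
      refine Fintype.linearIndependent_iff.1 (hg p) (fun k => c (p, k)) ?_
      ext i
      have hi := congrFun hc (i, p)
      rw [Finset.sum_apply, Fintype.sum_prod_type, Finset.sum_eq_single p] at hi
      · simpa using hi
      · intro q _ hq
        refine Finset.sum_eq_zero fun k _ => ?_
        rcases hq.lt_or_gt with hq | hq
        · simp [htri _ _ _ _ hq]
        · simp [ih q hq k]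
      · simp
  calc b * r = Fintype.card (Fin b × Fin r) := by simp
    _ = Module.finrank F (Submodule.span F (Set.range
          fun x : Fin b × Fin r => A.col (g x.1 x.2, x.1))) := (finrank_span_eq_card hli).symm
    _ ≤ A.rank := by
      rw [Matrix.rank_eq_finrank_span_cols]
      refine Submodule.finrank_mono (Submodule.span_mono ?_)
      rintro _ ⟨x, rfl⟩
      exact ⟨_, rfl⟩

/-- If `A` is a completion of `(J,a) ⊗ I_b` all of whose
`b × b` blocks `A^{(i,j)} = (A_{(i,p),(j,q)})_{p,q}` are upper triangular
(entries with `p > q` vanish), then `rank(A) ≥ b · mr(J,a)`. -/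
theorem stmt12 {F : Type*} [Field F] (m n : ℕ)
    (J : Set (Fin m × Fin n)) (a : Fin m → Fin n → F)
    (b : ℕ) (hb : 1 ≤ b)
    (A : Matrix (Fin m × Fin b) (Fin n × Fin b) F)
    (hA : Completes (TensorJ J b) (TensorA a b) A)
    (htri : ∀ (i : Fin m) (j : Fin n) (p q : Fin b), q < p → A (i, p) (j, q) = 0) :
    b * pmr J a ≤ A.rank := by
  refine Matrix.mul_le_rank_of_blockUpperTriangular A htri fun p => pmr_le_rank fun x hx => ?_
  simpa [TensorA] using hA ((x.1, p), (x.2, p)) hx
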